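/- arXiv:1502.00083 — 4 statements merged into one kernel-verified Lean document; each statement's English description precedes it below -/
import Mathlib

section
/- Let B, C be bounded linear operators on a nonzero complex Hilbert space H. If p ≥ 2, then 2^{1/p - 1} · w_p(B+C, B-C) ≤ w_p(B,C) ≤ 2^{-1/p} · w_p(B+C, B-C). If 1 < p ≤ 2, both inequalities hold in the opposite direction. -/
open scoped InnerProductSpace
open ContinuousLinearMap Complex

variable {H : Type*} [NormedAddCommGroup H] [InnerProductSpace ℂ H] [CompleteSpace H] [Nontrivial H]

/-- The numerical radius of a bounded linear operator. -/
noncomputable def nrad (T : H →L[ℂ] H) : ℝ :=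
  ⨆ x : {x : H // ‖x‖ = 1}, ‖⟪T x, x⟫_ℂ‖

/-- The generalized Euclidean operator radius `w_p` of a pair of operators. -/
noncomputable def wp2 (p : ℝ) (B C : H →L[ℂ] H) : ℝ :=
  ⨆ x : {x : H // ‖x‖ = 1}, (‖⟪B x, x⟫_ℂ‖ ^ p + ‖⟪C x, x⟫_ℂ‖ ^ p) ^ (1/p)

theorem two_mul_add_rpow_le_of_two_le {p : ℝ} (hp : 2 ≤ p) (a b : ℂ) :
    2 * (‖a‖ ^ p + ‖b‖ ^ p) ≤ ‖a + b‖ ^ p + ‖a - b‖ ^ p := by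
  have hq : 1 ≤ p / 2 := by linarith
  have hsq (z : ℂ) : ‖z‖ ^ p = (‖z‖ ^ 2) ^ (p / 2) := by
    rw [← Real.rpow_natCast_mul (norm_nonneg z)]
    congr 1
    push_cast
    ring
  have hpar := parallelogram_law_with_norm ℂ a b
  have hconv := (convexOn_rpow hq).2 (Set.mem_Ici.2 (sq_nonneg ‖a + b‖))
    (Set.mem_Ici.2 (sq_nonneg ‖a - b‖)) (by norm_num : (0 : ℝ) ≤ 1 / 2)
    (by norm_num : (0 : ℝ) ≤ 1 / 2) (by norm_num)
  have hmid : (1 / 2 : ℝ) • ‖a + b‖ ^ 2 + (1 / 2 : ℝ) • ‖a - b‖ ^ 2 = ‖a‖ ^ 2 + ‖b‖ ^ 2 := by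
    simp only [smul_eq_mul]
    linarith
  have hadd := Real.add_rpow_le_rpow_add (sq_nonneg ‖a‖) (sq_nonneg ‖b‖) hq
  rw [hmid] at hconv
  simp only [smul_eq_mul] at hconv
  simp only [hsq]
  linarith

theorem add_rpow_le_two_mul_of_le_two {p : ℝ} (hp : 0 < p) (hp2 : p ≤ 2) (a b : ℂ) :
    ‖a + b‖ ^ p + ‖a - b‖ ^ p ≤ 2 * (‖a‖ ^ p + ‖b‖ ^ p) := by
  have hq0 : 0 ≤ p / 2 := by linarith
  have hq : p / 2 ≤ 1 := by linarith
  have hsq (z : ℂ) : ‖z‖ ^ p = (‖z‖ ^ 2) ^ (p / 2) := by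
    rw [← Real.rpow_natCast_mul (norm_nonneg z)]
    congr 1
    push_cast
    ring
  have hpar := parallelogram_law_with_norm ℂ a b
  have hconc := (Real.concaveOn_rpow hq0 hq).2 (Set.mem_Ici.2 (sq_nonneg ‖a + b‖))
    (Set.mem_Ici.2 (sq_nonneg ‖a - b‖)) (by norm_num : (0 : ℝ) ≤ 1 / 2)
    (by norm_num : (0 : ℝ) ≤ 1 / 2) (by norm_num)
  have hmid : (1 / 2 : ℝ) • ‖a + b‖ ^ 2 + (1 / 2 : ℝ) • ‖a - b‖ ^ 2 = ‖a‖ ^ 2 + ‖b‖ ^ 2 := by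
    simp only [smul_eq_mul]
    linarith
  have hadd := Real.rpow_add_le_add_rpow (sq_nonneg ‖a‖) (sq_nonneg ‖b‖) hq0 hq
  rw [hmid] at hconc
  simp only [smul_eq_mul] at hconc
  simp only [hsq]
  linarith

theorem wp2_bddAbove {V : Type*} [NormedAddCommGroup V] [InnerProductSpace ℂ V]
    {p : ℝ} (hp : 0 < p) (B C : V →L[ℂ] V) :
    BddAbove (Set.range fun x : {x : V // ‖x‖ = 1} =>
      (‖⟪B x, x⟫_ℂ‖ ^ p + ‖⟪C x, x⟫_ℂ‖ ^ p) ^ (1/p)) := by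
  have hbound (T : V →L[ℂ] V) (x : {x : V // ‖x‖ = 1}) : ‖⟪T x, x⟫_ℂ‖ ≤ ‖T‖ := by
    calc ‖⟪T x, x⟫_ℂ‖ ≤ ‖T x‖ * ‖(x : V)‖ := norm_inner_le_norm _ _
      _ ≤ ‖T‖ := by simpa [x.2] using T.le_opNorm x
  refine ⟨(‖B‖ ^ p + ‖C‖ ^ p) ^ (1/p), ?_⟩
  rintro _ ⟨x, rfl⟩
  have hB := hbound B x
  have hC := hbound C x
  dsimp only
  gcongr

theorem wp2_le_mul_wp2 {V : Type*} [NormedAddCommGroup V] [InnerProductSpace ℂ V]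
    {p c : ℝ} (hp : 0 < p) (hc : 0 ≤ c) {B C D F : V →L[ℂ] V}
    (h : ∀ x : V, ‖⟪B x, x⟫_ℂ‖ ^ p + ‖⟪C x, x⟫_ℂ‖ ^ p ≤
      c * (‖⟪D x, x⟫_ℂ‖ ^ p + ‖⟪F x, x⟫_ℂ‖ ^ p)) :
    wp2 p B C ≤ c ^ (1/p) * wp2 p D F := by
  unfold wp2
  rw [Real.mul_iSup_of_nonneg (by positivity)]
  refine ciSup_mono ?_ fun x => ?_
  · obtain ⟨M, hM⟩ := wp2_bddAbove hp D F
    refine ⟨c ^ (1/p) * M, ?_⟩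
    rintro _ ⟨x, rfl⟩
    exact mul_le_mul_of_nonneg_left (hM ⟨x, rfl⟩) (by positivity)
  · rw [← Real.mul_rpow hc (by positivity)]
    exact Real.rpow_le_rpow (by positivity) (h x) (by positivity)

theorem stmt6 (B C : H →L[ℂ] H) (p : ℝ) :
    (2 ≤ p →
      (2 : ℝ) ^ (1/p - 1) * wp2 p (B + C) (B - C) ≤ wp2 p B C ∧
      wp2 p B C ≤ (2 : ℝ) ^ (-(1/p)) * wp2 p (B + C) (B - C)) ∧
    (1 < p → p ≤ 2 →
      wp2 p B C ≤ (2 : ℝ) ^ (1/p - 1) * wp2 p (B + C) (B - C) ∧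
      (2 : ℝ) ^ (-(1/p)) * wp2 p (B + C) (B - C) ≤ wp2 p B C) := by
  have htwo (k : ℝ) : ((2 : ℝ) ^ k) ^ (1/p) = 2 ^ (k * (1/p)) :=
    (Real.rpow_mul (by norm_num) _ _).symm
  have hcancel {k u v : ℝ} (h : u ≤ (2 : ℝ) ^ (-k) * v) : 2 ^ k * u ≤ v := by
    calc (2 : ℝ) ^ k * u ≤ 2 ^ k * (2 ^ (-k) * v) := by gcongr
      _ = v := by rw [← mul_assoc, ← Real.rpow_add (by norm_num), add_neg_cancel]; simp
  have hdouble (a b : ℂ) : ‖(a + b) + (a - b)‖ ^ p + ‖(a + b) - (a - b)‖ ^ p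
      = 2 * (2 ^ (p - 1) * (‖a‖ ^ p + ‖b‖ ^ p)) := by
    have ha : (a + b) + (a - b) = 2 * a := by ring
    have hb : (a + b) - (a - b) = 2 * b := by ring
    rw [ha, hb, norm_mul, norm_mul, Complex.norm_ofNat, Real.mul_rpow (by norm_num) (norm_nonneg a),
      Real.mul_rpow (by norm_num) (norm_nonneg b), Real.rpow_sub_one (by norm_num)]
    ring
  refine ⟨fun hp => ?_, fun hp1 hp => ?_⟩
  · have hp0 : 0 < p := by linarith
    constructor
    · apply hcancel
      have hexp : -(1/p - 1) = (p - 1) * (1/p) := by field_simp; ring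
      rw [hexp, ← htwo]
      refine wp2_le_mul_wp2 hp0 (by positivity) fun x => ?_
      simp only [_root_.add_apply, _root_.sub_apply, inner_add_left,
        inner_sub_left]
      have h := two_mul_add_rpow_le_of_two_le hp (⟪B x, x⟫_ℂ + ⟪C x, x⟫_ℂ)
        (⟪B x, x⟫_ℂ - ⟪C x, x⟫_ℂ)
      rw [hdouble] at h
      linarith
    · rw [← neg_one_mul, ← htwo]
      refine wp2_le_mul_wp2 hp0 (by positivity) fun x => ?_
      simp only [_root_.add_apply, _root_.sub_apply, inner_add_left,
        inner_sub_left, Real.rpow_neg_one]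
      linarith [two_mul_add_rpow_le_of_two_le hp ⟪B x, x⟫_ℂ ⟪C x, x⟫_ℂ]
  · have hp0 : 0 < p := by linarith
    constructor
    · have hexp : 1/p - 1 = (-(p - 1)) * (1/p) := by field_simp; ring
      rw [hexp, ← htwo]
      refine wp2_le_mul_wp2 hp0 (by positivity) fun x => ?_
      simp only [_root_.add_apply, _root_.sub_apply, inner_add_left,
        inner_sub_left]
      have h := add_rpow_le_two_mul_of_le_two hp0 hp (⟪B x, x⟫_ℂ + ⟪C x, x⟫_ℂ)
        (⟪B x, x⟫_ℂ - ⟪C x, x⟫_ℂ)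
      rw [hdouble] at h
      rw [Real.rpow_neg (by norm_num), ← div_eq_inv_mul, le_div_iff₀' (by positivity)]
      linarith
    · apply hcancel
      rw [neg_neg, ← one_mul (1/p), ← htwo]
      refine wp2_le_mul_wp2 hp0 (by positivity) fun x => ?_
      simp only [_root_.add_apply, _root_.sub_apply, inner_add_left,
        inner_sub_left, Real.rpow_one]
      exact add_rpow_le_two_mul_of_le_two hp0 hp ⟪B x, x⟫_ℂ ⟪C x, x⟫_ℂ
end

section
/- Let B, C be bounded linear operators on a nonzero complex Hilbert space H and let p ≥ 1. Then w_p(B,C) ≥ 2^{1/p - 1} · w(B² + C²)^{1/2}. -/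
open scoped InnerProductSpace
open ContinuousLinearMap Complex

variable {H : Type*} [NormedAddCommGroup H] [InnerProductSpace ℂ H] [CompleteSpace H] [Nontrivial H]

section Helpers

variable {E : Type*} [NormedAddCommGroup E] [InnerProductSpace ℂ E]

lemma re_inner_sq_le_of_numericalRange_le {T : E →L[ℂ] E} {m : ℝ} (hm : 0 < m)
    (hT : ∀ u, ‖⟪T u, u⟫_ℂ‖ ≤ m * ‖u‖ ^ 2) (x : E) :
    (⟪(T ^ 2) x, x⟫_ℂ).re ≤ m ^ 2 * ‖x‖ ^ 2 := by
  have key : ∀ u : E, 0 ≤ m * (⟪u, u⟫_ℂ).re - (⟪T u, u⟫_ℂ).re := fun u => by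
    have h1 : (⟪u, u⟫_ℂ).re = ‖u‖ ^ 2 := inner_self_eq_norm_sq (𝕜 := ℂ) u
    have h2 := (Complex.re_le_norm _).trans (hT u)
    rw [h1]; linarith
  have key' : ∀ u : E, 0 ≤ m * (⟪u, u⟫_ℂ).re + (⟪T u, u⟫_ℂ).re := fun u => by
    have h1 : (⟪u, u⟫_ℂ).re = ‖u‖ ^ 2 := inner_self_eq_norm_sq (𝕜 := ℂ) u
    have h2 := (neg_le_abs _).trans ((Complex.abs_re_le_norm _).trans (hT u))
    rw [h1]; linarith
  have h1 := key ((m : ℂ) • x + T x)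
  have h2 := key' ((m : ℂ) • x - T x)
  have hx : (⟪x, x⟫_ℂ).re = ‖x‖ ^ 2 := inner_self_eq_norm_sq (𝕜 := ℂ) x
  simp only [map_add, map_sub, map_smul, inner_add_left, inner_add_right, inner_sub_left,
    inner_sub_right, inner_smul_left, inner_smul_right, Complex.conj_ofReal, Complex.add_re,
    Complex.sub_re, Complex.re_ofReal_mul, hx] at h1 h2
  have h3 : (T ^ 2) x = T (T x) := by rw [pow_two]; rfl
  rw [h3]
  have : 0 ≤ m * (m ^ 2 * ‖x‖ ^ 2 - (⟪T (T x), x⟫_ℂ).re) := by nlinarith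
  linarith [nonneg_of_mul_nonneg_right this hm]

lemma norm_inner_sq_le_of_numericalRange_le {T : E →L[ℂ] E} {m : ℝ} (hm : 0 ≤ m)
    (hT : ∀ u, ‖⟪T u, u⟫_ℂ‖ ≤ m * ‖u‖ ^ 2) (x : E) :
    ‖⟪(T ^ 2) x, x⟫_ℂ‖ ≤ m ^ 2 * ‖x‖ ^ 2 := by
  have pos : ∀ r, m < r → ‖⟪(T ^ 2) x, x⟫_ℂ‖ ≤ r ^ 2 * ‖x‖ ^ 2 := fun r hr => by
    set v := ⟪(T ^ 2) x, x⟫_ℂ with hv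
    set z : ℂ := Complex.exp ((v.arg / 2 : ℝ) * I) with hz
    have hz1 : ‖z‖ = 1 := Complex.norm_exp_ofReal_mul_I _
    have hzT : ∀ u, ‖⟪(z • T) u, u⟫_ℂ‖ ≤ r * ‖u‖ ^ 2 := fun u => by
      rw [smul_apply, inner_smul_left, norm_mul, RCLike.norm_conj, hz1, one_mul]
      exact (hT u).trans (by gcongr)
    have h := re_inner_sq_le_of_numericalRange_le (hm.trans_lt hr) hzT x
    have hz2 : z ^ 2 = Complex.exp (v.arg * I) := by
      rw [hz, ← Complex.exp_nat_mul]; congr 1; push_cast; ring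
    have hconj : (starRingEnd ℂ) (z ^ 2) * v = ‖v‖ := by
      have hw : (starRingEnd ℂ) (z ^ 2) * z ^ 2 = 1 := by
        rw [mul_comm, Complex.mul_conj, Complex.normSq_eq_norm_sq, norm_pow, hz1]; simp
      calc (starRingEnd ℂ) (z ^ 2) * v
          = (starRingEnd ℂ) (z ^ 2) * (‖v‖ * z ^ 2) := by
            rw [hz2, Complex.norm_mul_exp_arg_mul_I]
        _ = ‖v‖ * ((starRingEnd ℂ) (z ^ 2) * z ^ 2) := by ring
        _ = ‖v‖ := by rw [hw, mul_one]
    rw [smul_pow, smul_apply, inner_smul_left, ← hv, hconj, Complex.ofReal_re] at h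
    exact h
  have hcont : Filter.Tendsto (fun r : ℝ => r ^ 2 * ‖x‖ ^ 2) (nhdsWithin m (Set.Ioi m))
      (nhds (m ^ 2 * ‖x‖ ^ 2)) :=
    ((by fun_prop : Continuous fun r : ℝ => r ^ 2 * ‖x‖ ^ 2).tendsto m).mono_left
      nhdsWithin_le_nhds
  exact ge_of_tendsto hcont (by filter_upwards [self_mem_nhdsWithin] with r hr using pos r hr)

lemma norm_inner_le_mul_sq_of_unit {T : E →L[ℂ] E} {m : ℝ}
    (hT : ∀ u, ‖u‖ = 1 → ‖⟪T u, u⟫_ℂ‖ ≤ m) (u : E) : ‖⟪T u, u⟫_ℂ‖ ≤ m * ‖u‖ ^ 2 := by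
  rcases eq_or_ne u 0 with rfl | hu
  · simp
  have hn : 0 < ‖u‖ := norm_pos_iff.mpr hu
  have h := hT (((‖u‖⁻¹ : ℝ) : ℂ) • u) (by
    rw [norm_smul, Complex.norm_real, norm_inv, norm_norm, inv_mul_cancel₀ hn.ne'])
  rw [map_smul, inner_smul_left, inner_smul_right, norm_mul, norm_mul, RCLike.norm_conj,
    Complex.norm_real, norm_inv, norm_norm] at h
  calc ‖⟪T u, u⟫_ℂ‖ = ‖u‖⁻¹ * (‖u‖⁻¹ * ‖⟪T u, u⟫_ℂ‖) * ‖u‖ ^ 2 := by field_simp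
    _ ≤ m * ‖u‖ ^ 2 := by gcongr

lemma norm_inner_sq_add_sq_le {B C : E →L[ℂ] E} {m : ℝ} (hm : 0 ≤ m)
    (h : ∀ u, ‖u‖ = 1 → ‖⟪B u, u⟫_ℂ‖ + ‖⟪C u, u⟫_ℂ‖ ≤ m) (x : E) :
    ‖⟪(B ^ 2 + C ^ 2) x, x⟫_ℂ‖ ≤ m ^ 2 * ‖x‖ ^ 2 := by
  have h1 := norm_inner_sq_le_of_numericalRange_le (T := B + C) hm
    (norm_inner_le_mul_sq_of_unit fun u hu => by
      rw [add_apply, inner_add_left]; exact (norm_add_le _ _).trans (h u hu)) x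
  have h2 := norm_inner_sq_le_of_numericalRange_le (T := B - C) hm
    (norm_inner_le_mul_sq_of_unit fun u hu => by
      rw [sub_apply, inner_sub_left]; exact (norm_sub_le _ _).trans (h u hu)) x
  have hop : (B + C) ^ 2 + (B - C) ^ 2 = (B ^ 2 + C ^ 2) + (B ^ 2 + C ^ 2) := by noncomm_ring
  have heq : ⟪((B + C) ^ 2) x, x⟫_ℂ + ⟪((B - C) ^ 2) x, x⟫_ℂ
      = 2 * ⟪(B ^ 2 + C ^ 2) x, x⟫_ℂ := by
    rw [← inner_add_left, ← add_apply, hop, add_apply, inner_add_left, two_mul]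
  have h3 := norm_add_le ⟪((B + C) ^ 2) x, x⟫_ℂ ⟪((B - C) ^ 2) x, x⟫_ℂ
  rw [heq, norm_mul, Complex.norm_ofNat] at h3
  linarith

lemma norm_inner_apply_self_le {T : E →L[ℂ] E} {x : E} (hx : ‖x‖ = 1) :
    ‖⟪T x, x⟫_ℂ‖ ≤ ‖T‖ := by
  have h1 := norm_inner_le_norm (𝕜 := ℂ) (T x) x
  have h2 := T.le_opNorm x
  rw [hx, mul_one] at h1 h2
  exact h1.trans h2

end Helpers

lemma add_le_two_rpow_mul_rpow_add_rpow {a b p : ℝ} (ha : 0 ≤ a) (hb : 0 ≤ b) (hp : 1 ≤ p) :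
    a + b ≤ (2 : ℝ) ^ (1 - 1 / p) * (a ^ p + b ^ p) ^ (1 / p) := by
  have hp0 : 0 < p := by linarith
  have h : (a + b) ^ p ≤ (2 : ℝ) ^ (p - 1) * (a ^ p + b ^ p) := by
    lift a to NNReal using ha
    lift b to NNReal using hb
    exact_mod_cast NNReal.rpow_add_le_mul_rpow_add_rpow a b hp
  have h' := Real.rpow_le_rpow (by positivity) h (z := 1 / p) (by positivity)
  rw [Real.mul_rpow (by positivity) (by positivity), ← Real.rpow_mul (by positivity),
    ← Real.rpow_mul (by positivity), mul_one_div_cancel hp0.ne', Real.rpow_one] at h'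
  convert h' using 3
  field_simp

theorem stmt8 (B C : H →L[ℂ] H) (p : ℝ) (hp : 1 ≤ p) :
    wp2 p B C ≥ (2 : ℝ) ^ (1/p - 1) * nrad (B ^ 2 + C ^ 2) ^ ((1 : ℝ)/2) := by
  have hp0 : 0 < p := by linarith
  have hbdd : BddAbove (Set.range fun x : {x : H // ‖x‖ = 1} =>
      (‖⟪B x, x⟫_ℂ‖ ^ p + ‖⟪C x, x⟫_ℂ‖ ^ p) ^ (1/p)) := by
    refine ⟨(‖B‖ ^ p + ‖C‖ ^ p) ^ (1/p), ?_⟩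
    rintro _ ⟨x, rfl⟩
    have hB := norm_inner_apply_self_le (T := B) x.2
    have hC := norm_inner_apply_self_le (T := C) x.2
    dsimp only
    gcongr
  have hW : 0 ≤ wp2 p B C := Real.iSup_nonneg fun x => by positivity
  set K := (2 : ℝ) ^ (1 - 1 / p) * wp2 p B C with hK
  have hK0 : 0 ≤ K := by positivity
  have hsum : ∀ u : H, ‖u‖ = 1 → ‖⟪B u, u⟫_ℂ‖ + ‖⟪C u, u⟫_ℂ‖ ≤ K := fun u hu =>
    (add_le_two_rpow_mul_rpow_add_rpow (norm_nonneg _) (norm_nonneg _) hp).trans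
      (mul_le_mul_of_nonneg_left (le_ciSup hbdd ⟨u, hu⟩) (by positivity))
  have hn : nrad (B ^ 2 + C ^ 2) ≤ K ^ 2 := Real.iSup_le (fun x => by
    simpa [x.2] using norm_inner_sq_add_sq_le hK0 hsum (x : H)) (by positivity)
  rw [← Real.sqrt_eq_rpow]
  calc (2 : ℝ) ^ (1/p - 1) * √(nrad (B ^ 2 + C ^ 2))
      ≤ (2 : ℝ) ^ (1/p - 1) * K := by gcongr; exact Real.sqrt_le_iff.mpr ⟨hK0, hn⟩
    _ = wp2 p B C := by
      rw [hK, ← mul_assoc, ← Real.rpow_add two_pos]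
      simp
end

section
/- Let A be a bounded linear operator on a nonzero complex Hilbert space H with Cartesian decomposition A = B + iC (so B = (A + A*)/2 and C = (A - A*)/(2i) are self-adjoint), and let p ≥ 2. Then w_p(B,C) ≥ 2^{1/p - 1} · ‖B² + C²‖^{1/2}, and w(A) ≥ 2^{1/p - 3/2} · ‖A*A + AA*‖^{1/2}. -/
open scoped InnerProductSpace
open ContinuousLinearMap Complex

variable {H : Type*} [NormedAddCommGroup H] [InnerProductSpace ℂ H] [CompleteSpace H] [Nontrivial H]

/-- A bound on the quadratic form of a self-adjoint operator on unit vectors bounds its norm. -/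
theorem IsSelfAdjoint.norm_le_of_norm_inner_le {E : Type*} [NormedAddCommGroup E]
    [InnerProductSpace ℂ E] [CompleteSpace E] {S : E →L[ℂ] E} (hS : IsSelfAdjoint S) {m : ℝ}
    (hm : 0 ≤ m) (h : ∀ x : E, ‖x‖ = 1 → ‖⟪S x, x⟫_ℂ‖ ≤ m) : ‖S‖ ≤ m := by
  rw [S.norm_eq_iSup_rayleighQuotient hS.isSymmetric]
  refine ciSup_le fun x => ?_
  by_cases hx : x = 0
  · simpa [hx] using hm
  have hx' : ‖x‖ ≠ 0 := norm_ne_zero_iff.mpr hx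
  have hc : ((‖x‖ : ℂ)⁻¹) ≠ 0 := inv_ne_zero (by exact_mod_cast hx')
  have hunit : ‖(‖x‖ : ℂ)⁻¹ • x‖ = 1 := by simp [norm_smul, hx']
  rw [← S.rayleigh_smul x hc, rayleighQuotient, hunit, reApplyInnerSelf_apply, one_pow, div_one]
  exact (Complex.abs_re_le_norm _).trans (h _ hunit)

theorem IsSelfAdjoint.norm_sq_add_sq_le {E : Type*} [NormedAddCommGroup E]
    [InnerProductSpace ℂ E] [CompleteSpace E] {B C : E →L[ℂ] E} (hB : IsSelfAdjoint B)
    (hC : IsSelfAdjoint C) {m : ℝ} (hm : 0 ≤ m)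
    (h : ∀ x : E, ‖x‖ = 1 → ‖⟪B x, x⟫_ℂ‖ + ‖⟪C x, x⟫_ℂ‖ ≤ m) : ‖B ^ 2 + C ^ 2‖ ≤ m ^ 2 := by
  have hadd : ‖B + C‖ ≤ m := (hB.add hC).norm_le_of_norm_inner_le hm fun x hx => by
    rw [add_apply, inner_add_left]
    exact (norm_add_le _ _).trans (h x hx)
  have hsub : ‖B - C‖ ≤ m := (hB.sub hC).norm_le_of_norm_inner_le hm fun x hx => by
    rw [sub_apply, inner_sub_left]
    exact (norm_sub_le _ _).trans (h x hx)
  have key : (2 : ℂ) • (B ^ 2 + C ^ 2) = (B + C) * (B + C) + (B - C) * (B - C) := by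
    rw [two_smul]
    noncomm_ring
  have h2 : 2 * ‖B ^ 2 + C ^ 2‖ ≤ m * m + m * m := by
    calc 2 * ‖B ^ 2 + C ^ 2‖ = ‖(2 : ℂ) • (B ^ 2 + C ^ 2)‖ := by
          rw [norm_smul, Complex.norm_ofNat]
      _ ≤ ‖B + C‖ * ‖B + C‖ + ‖B - C‖ * ‖B - C‖ := by
        rw [key]
        exact (norm_add_le _ _).trans (add_le_add (norm_mul_le _ _) (norm_mul_le _ _))
      _ ≤ m * m + m * m := by gcongr
  linarith

theorem Real.two_rpow_mul_add_le_rpow_add_rpow {p b c : ℝ} (hp : 1 ≤ p) (hb : 0 ≤ b)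
    (hc : 0 ≤ c) : (2 : ℝ) ^ (1 / p - 1) * (b + c) ≤ (b ^ p + c ^ p) ^ (1 / p) := by
  have hp0 : 0 < p := by linarith
  have h : (b + c) ^ p ≤ 2 ^ (p - 1) * (b ^ p + c ^ p) := by
    lift b to NNReal using hb
    lift c to NNReal using hc
    exact_mod_cast NNReal.rpow_add_le_mul_rpow_add_rpow b c hp
  have hs : 0 ≤ b ^ p + c ^ p := by positivity
  rw [one_div, Real.le_rpow_inv_iff_of_pos (by positivity) hs hp0,
    Real.mul_rpow (by positivity) (by positivity), ← Real.rpow_mul (by norm_num)]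
  calc (2 : ℝ) ^ ((p⁻¹ - 1) * p) * (b + c) ^ p
      ≤ 2 ^ ((p⁻¹ - 1) * p) * (2 ^ (p - 1) * (b ^ p + c ^ p)) := by gcongr
    _ = b ^ p + c ^ p := by
      rw [← mul_assoc, ← Real.rpow_add (by norm_num)]
      have : (p⁻¹ - 1) * p + (p - 1) = 0 := by field_simp; ring
      rw [this, Real.rpow_zero, one_mul]

theorem Complex.abs_re_add_abs_im_le_sqrt_two_mul_norm (z : ℂ) :
    |z.re| + |z.im| ≤ √2 * ‖z‖ := by
  refine abs_le_of_sq_le_sq' ?_ (by positivity) |>.2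
  rw [mul_pow, Real.sq_sqrt (by norm_num), Complex.sq_norm, Complex.normSq_apply]
  nlinarith [sq_nonneg (|z.re| - |z.im|), sq_abs z.re, sq_abs z.im]

theorem norm_inner_self_le_norm_of_norm_eq_one {E : Type*} [NormedAddCommGroup E]
    [InnerProductSpace ℂ E] (T : E →L[ℂ] E) {x : E} (hx : ‖x‖ = 1) : ‖⟪T x, x⟫_ℂ‖ ≤ ‖T‖ := by
  simpa [hx] using (norm_inner_le_norm (𝕜 := ℂ) (T x) x).trans
    (mul_le_mul_of_nonneg_right (T.le_opNorm x) (norm_nonneg x))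

theorem norm_inner_le_nrad {E : Type*} [NormedAddCommGroup E] [InnerProductSpace ℂ E]
    (T : E →L[ℂ] E) {x : E} (hx : ‖x‖ = 1) : ‖⟪T x, x⟫_ℂ‖ ≤ nrad T :=
  le_ciSup (f := fun x : {x : E // ‖x‖ = 1} => ‖⟪T x, x⟫_ℂ‖)
    ⟨‖T‖, by rintro _ ⟨y, rfl⟩; exact norm_inner_self_le_norm_of_norm_eq_one T y.2⟩ ⟨x, hx⟩

theorem rpow_add_rpow_le_wp2 {E : Type*} [NormedAddCommGroup E] [InnerProductSpace ℂ E]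
    {p : ℝ} (hp : 0 ≤ p) (B C : E →L[ℂ] E) {x : E} (hx : ‖x‖ = 1) :
    (‖⟪B x, x⟫_ℂ‖ ^ p + ‖⟪C x, x⟫_ℂ‖ ^ p) ^ (1 / p) ≤ wp2 p B C := by
  refine le_ciSup (f := fun x : {x : E // ‖x‖ = 1} =>
    (‖⟪B x, x⟫_ℂ‖ ^ p + ‖⟪C x, x⟫_ℂ‖ ^ p) ^ (1 / p))
    ⟨(‖B‖ ^ p + ‖C‖ ^ p) ^ (1 / p), ?_⟩ ⟨x, hx⟩
  rintro _ ⟨y, rfl⟩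
  have h₁ := norm_inner_self_le_norm_of_norm_eq_one B y.2
  have h₂ := norm_inner_self_le_norm_of_norm_eq_one C y.2
  dsimp only
  gcongr

theorem stmt9 (A B C : H →L[ℂ] H)
    (hB : B = (2 : ℂ)⁻¹ • (A + adjoint A))
    (hC : C = (2 * Complex.I)⁻¹ • (A - adjoint A))
    (p : ℝ) (hp : 2 ≤ p) :
    wp2 p B C ≥ (2 : ℝ) ^ (1/p - 1) * ‖B ^ 2 + C ^ 2‖ ^ ((1 : ℝ)/2) ∧
    nrad A ≥ (2 : ℝ) ^ (1/p - 3/2) * ‖adjoint A * A + A * adjoint A‖ ^ ((1 : ℝ)/2) := by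
  have hBs : IsSelfAdjoint B := by
    rw [hB, isSelfAdjoint_iff, star_smul, star_add, star_eq_adjoint, star_eq_adjoint,
      adjoint_adjoint, add_comm]
    simp
  have hCs : IsSelfAdjoint C := by
    rw [hC, isSelfAdjoint_iff, star_smul, star_sub, star_eq_adjoint, star_eq_adjoint,
      adjoint_adjoint, ← neg_sub A, smul_neg, ← neg_smul]
    simp
  have sqrt_le {m : ℝ} (hm : 0 ≤ m)
      (h : ∀ x : H, ‖x‖ = 1 → ‖⟪B x, x⟫_ℂ‖ + ‖⟪C x, x⟫_ℂ‖ ≤ m) :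
      ‖B ^ 2 + C ^ 2‖ ^ ((1 : ℝ) / 2) ≤ m := by
    rw [← Real.sqrt_eq_rpow]
    exact Real.sqrt_le_iff.mpr ⟨hm, hBs.norm_sq_add_sq_le hCs hm h⟩
  constructor
  · have hpos : (0 : ℝ) < 2 ^ (1 / p - 1) := by positivity
    rw [ge_iff_le, mul_comm, ← le_div_iff₀ hpos]
    refine sqrt_le (div_nonneg (Real.iSup_nonneg fun _ => by positivity) hpos.le) fun x hx => ?_
    rw [le_div_iff₀ hpos, mul_comm]
    exact (Real.two_rpow_mul_add_le_rpow_add_rpow (by linarith) (norm_nonneg _)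
      (norm_nonneg _)).trans (rpow_add_rpow_le_wp2 (by linarith) B C hx)
  · have hAA : adjoint A * A + A * adjoint A = (2 : ℂ) • (B ^ 2 + C ^ 2) := by
      have hI : ((2 * Complex.I)⁻¹ : ℂ) * (2 * Complex.I)⁻¹ = -(4 : ℂ)⁻¹ := by
        rw [← mul_inv, mul_mul_mul_comm, Complex.I_mul_I]
        norm_num
      rw [hB, hC, sq, sq, smul_mul_smul_comm, smul_mul_smul_comm, hI]
      simp only [mul_add, add_mul, mul_sub, sub_mul]
      module
    have hn : 0 ≤ nrad A := Real.iSup_nonneg fun _ => norm_nonneg _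
    have hle : ‖B ^ 2 + C ^ 2‖ ^ ((1 : ℝ) / 2) ≤ √2 * nrad A := by
      refine sqrt_le (by positivity) fun x hx => ?_
      have hz : ⟪adjoint A x, x⟫_ℂ = (starRingEnd ℂ) ⟪A x, x⟫_ℂ := by
        rw [adjoint_inner_left, inner_conj_symm]
      have hb : ‖⟪B x, x⟫_ℂ‖ = |(⟪A x, x⟫_ℂ).re| := by
        rw [hB, smul_apply, inner_smul_left, add_apply, inner_add_left, hz, Complex.add_conj]
        simp
      have hc : ‖⟪C x, x⟫_ℂ‖ = |(⟪A x, x⟫_ℂ).im| := by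
        rw [hC, smul_apply, inner_smul_left, sub_apply, inner_sub_left, hz, Complex.sub_conj]
        simp
      rw [hb, hc]
      exact (Complex.abs_re_add_abs_im_le_sqrt_two_mul_norm _).trans
        (mul_le_mul_of_nonneg_left (norm_inner_le_nrad A hx) (Real.sqrt_nonneg 2))
    have hexp : (2 : ℝ) ^ (1 / p - 3 / 2) ≤ 2 ^ (-1 : ℝ) := by
      refine Real.rpow_le_rpow_of_exponent_le (by norm_num) ?_
      have : 1 / p ≤ 1 / 2 := one_div_le_one_div_of_le (by norm_num) hp
      linarith
    rw [hAA, norm_smul, Complex.norm_ofNat, Real.mul_rpow (by norm_num) (norm_nonneg _),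
      ← Real.sqrt_eq_rpow 2]
    calc (2 : ℝ) ^ (1 / p - 3 / 2) * (√2 * ‖B ^ 2 + C ^ 2‖ ^ ((1 : ℝ) / 2))
        ≤ 2 ^ (-1 : ℝ) * (√2 * (√2 * nrad A)) := by gcongr
      _ = nrad A := by
        rw [← mul_assoc √2, Real.mul_self_sqrt (by norm_num), Real.rpow_neg_one]
        ring
end

section
/- Let B, C be bounded linear operators on a nonzero complex Hilbert space H and let p ≥ 2. Then w_p(B,C) ≥ 2^{2/p - 3/2} · w(B² + C²)^{1/2}. -/
open scoped InnerProductSpace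
open ContinuousLinearMap Complex

variable {H : Type*} [NormedAddCommGroup H] [InnerProductSpace ℂ H] [CompleteSpace H] [Nontrivial H]

set_option linter.unusedSectionVars false

theorem re_inner_sq_le {T : H →L[ℂ] H} {w : ℝ} (hw : 0 < w)
    (hT : ∀ x, ‖⟪T x, x⟫_ℂ‖ ≤ w * ‖x‖ ^ 2) (x : H) :
    (⟪T (T x), x⟫_ℂ).re ≤ w ^ 2 * ‖x‖ ^ 2 := by
  have hx : ∀ y : H, (⟪y, y⟫_ℂ).re = ‖y‖ ^ 2 := fun y ↦ by
    rw [inner_self_eq_norm_sq_to_K]; norm_cast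
  have hminus : ∀ y, 0 ≤ (⟪(w : ℂ) • y - T y, y⟫_ℂ).re := fun y ↦ by
    have h := (abs_le.1 ((Complex.abs_re_le_norm _).trans (hT y))).2
    simp only [inner_sub_left, inner_smul_left, conj_ofReal, sub_re, re_ofReal_mul, hx]
    linarith
  have hplus : ∀ y, 0 ≤ (⟪(w : ℂ) • y + T y, y⟫_ℂ).re := fun y ↦ by
    have h := (abs_le.1 ((Complex.abs_re_le_norm _).trans (hT y))).1
    simp only [inner_add_left, inner_smul_left, conj_ofReal, add_re, re_ofReal_mul, hx]
    linarith
  have key := add_nonneg (hminus ((w : ℂ) • x + T x)) (hplus ((w : ℂ) • x - T x))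
  have e : (⟪(w : ℂ) • ((w : ℂ) • x + T x) - T ((w : ℂ) • x + T x), (w : ℂ) • x + T x⟫_ℂ).re
      + (⟪(w : ℂ) • ((w : ℂ) • x - T x) + T ((w : ℂ) • x - T x), (w : ℂ) • x - T x⟫_ℂ).re
      = 2 * w * (w ^ 2 * ‖x‖ ^ 2 - (⟪T (T x), x⟫_ℂ).re) := by
    simp only [map_add, map_sub, map_smul, inner_sub_left, inner_add_left, inner_sub_right,
      inner_add_right, inner_smul_left, inner_smul_right, conj_ofReal, sub_re, add_re,
      re_ofReal_mul, hx]
    ring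
  rw [e] at key
  exact sub_nonneg.1 (nonneg_of_mul_nonneg_right key (by positivity))

/-- The power inequality `w(T²) ≤ w(T)²`, in terms of bounds on the quadratic form. -/
theorem norm_inner_sq_le {T : H →L[ℂ] H} {w : ℝ} (hw : 0 ≤ w)
    (hT : ∀ x, ‖⟪T x, x⟫_ℂ‖ ≤ w * ‖x‖ ^ 2) (x : H) :
    ‖⟪T (T x), x⟫_ℂ‖ ≤ w ^ 2 * ‖x‖ ^ 2 := by
  rcases hw.eq_or_lt with rfl | hw
  · have h0 : (T : H →ₗ[ℂ] H) = 0 := (inner_map_self_eq_zero _).1 fun y ↦ by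
      simpa using hT y
    have h1 : ∀ y, T y = 0 := fun y ↦ LinearMap.congr_fun h0 y
    simp [h1]
  set z := ⟪T (T x), x⟫_ℂ with hz
  set c : ℂ := exp ((z.arg / 2 : ℝ) * I) with hc
  have hcn : ‖c‖ = 1 := norm_exp_ofReal_mul_I _
  have h := re_inner_sq_le (T := c • T) hw (fun y ↦ by
    simpa [inner_smul_left, hcn] using hT y) x
  have hcc : (starRingEnd ℂ) c * c = 1 := by
    rw [← normSq_eq_conj_mul_self, normSq_eq_norm_sq, hcn]; simp
  have hzc : (‖z‖ : ℂ) * (c * c) = z := by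
    conv_rhs => rw [← norm_mul_exp_arg_mul_I z]
    rw [hc, ← Complex.exp_add]
    congr 2
    push_cast
    ring
  have e : ⟪(c • T) ((c • T) x), x⟫_ℂ = (‖z‖ : ℂ) := by
    simp only [_root_.smul_apply, map_smul, inner_smul_left, ← hz]
    linear_combination (-(starRingEnd ℂ) c ^ 2) * hzc +
      (‖z‖ : ℂ) * ((starRingEnd ℂ) c * c + 1) * hcc
  rw [e, ofReal_re] at h
  exact h

theorem norm_inner_map_self_le_of_unit {T : H →L[ℂ] H} {w : ℝ}
    (hT : ∀ x, ‖x‖ = 1 → ‖⟪T x, x⟫_ℂ‖ ≤ w) (x : H) : ‖⟪T x, x⟫_ℂ‖ ≤ w * ‖x‖ ^ 2 := by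
  rcases eq_or_ne x 0 with rfl | hx
  · simp
  have hn : 0 < ‖x‖ := norm_pos_iff.2 hx
  have h := hT (((‖x‖⁻¹ : ℝ) : ℂ) • x) (by
    rw [norm_smul, norm_real, norm_inv, norm_norm, inv_mul_cancel₀ hn.ne'])
  simp only [map_smul, inner_smul_left, inner_smul_right, norm_mul, conj_ofReal, norm_real,
    norm_inv, norm_norm] at h
  calc ‖⟪T x, x⟫_ℂ‖ = ‖x‖⁻¹ * (‖x‖⁻¹ * ‖⟪T x, x⟫_ℂ‖) * ‖x‖ ^ 2 := by field_simp
    _ ≤ w * ‖x‖ ^ 2 := by gcongr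

theorem norm_inner_map_self_le_norm (T : H →L[ℂ] H) {x : H} (hx : ‖x‖ = 1) :
    ‖⟪T x, x⟫_ℂ‖ ≤ ‖T‖ := by
  simpa [hx] using (norm_inner_le_norm (T x) x).trans
    (mul_le_mul_of_nonneg_right (T.le_opNorm x) (norm_nonneg x))

theorem le_wp2 {p : ℝ} (hp : 0 < p) (B C : H →L[ℂ] H) {x : H} (hx : ‖x‖ = 1) :
    (‖⟪B x, x⟫_ℂ‖ ^ p + ‖⟪C x, x⟫_ℂ‖ ^ p) ^ (1 / p) ≤ wp2 p B C := by
  refine le_ciSup (f := fun x : {x : H // ‖x‖ = 1} ↦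
    (‖⟪B x, x⟫_ℂ‖ ^ p + ‖⟪C x, x⟫_ℂ‖ ^ p) ^ (1 / p)) ?_ ⟨x, hx⟩
  refine ⟨(‖B‖ ^ p + ‖C‖ ^ p) ^ (1 / p), ?_⟩
  rintro _ ⟨⟨y, hy⟩, rfl⟩
  have hB := norm_inner_map_self_le_norm B hy
  have hC := norm_inner_map_self_le_norm C hy
  dsimp only
  gcongr

theorem stmt10 (B C : H →L[ℂ] H) (p : ℝ) (hp : 2 ≤ p) :
    wp2 p B C ≥ (2 : ℝ) ^ (2/p - 3/2) * nrad (B ^ 2 + C ^ 2) ^ ((1 : ℝ)/2) := by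
  have hp0 : 0 < p := by linarith
  set W := wp2 p B C with hW
  have hW0 : 0 ≤ W := Real.iSup_nonneg fun x ↦ by positivity
  have hB : ∀ x, ‖⟪B x, x⟫_ℂ‖ ≤ W * ‖x‖ ^ 2 := norm_inner_map_self_le_of_unit fun x hx ↦ by
    refine le_trans ?_ (le_wp2 hp0 B C hx)
    rw [one_div, Real.le_rpow_inv_iff_of_pos (by positivity) (by positivity) hp0]
    exact le_add_of_nonneg_right (by positivity)
  have hC : ∀ x, ‖⟪C x, x⟫_ℂ‖ ≤ W * ‖x‖ ^ 2 := norm_inner_map_self_le_of_unit fun x hx ↦ by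
    refine le_trans ?_ (le_wp2 hp0 B C hx)
    rw [one_div, Real.le_rpow_inv_iff_of_pos (by positivity) (by positivity) hp0]
    exact le_add_of_nonneg_left (by positivity)
  have hN0 : 0 ≤ nrad (B ^ 2 + C ^ 2) := Real.iSup_nonneg fun x ↦ norm_nonneg _
  have hN : nrad (B ^ 2 + C ^ 2) ≤ 2 * W ^ 2 := by
    refine Real.iSup_le (fun ⟨x, hx⟩ ↦ ?_) (by positivity)
    have h1 := norm_inner_sq_le hW0 hB x
    have h2 := norm_inner_sq_le hW0 hC x
    rw [hx] at h1 h2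
    have e : (B ^ 2 + C ^ 2) x = B (B x) + C (C x) := by simp [pow_two]
    dsimp only
    rw [e, inner_add_left]
    linarith [norm_add_le ⟪B (B x), x⟫_ℂ ⟪C (C x), x⟫_ℂ]
  have hexp : 2 / p - 3 / 2 ≤ -(1 / 2 : ℝ) := by
    have : 2 / p ≤ 1 := (div_le_one hp0).2 hp
    linarith
  calc (2 : ℝ) ^ (2 / p - 3 / 2) * nrad (B ^ 2 + C ^ 2) ^ ((1 : ℝ) / 2)
      ≤ (2 : ℝ) ^ (-(1 / 2 : ℝ)) * (2 * W ^ 2) ^ ((1 : ℝ) / 2) := by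
        gcongr
        norm_num
    _ = W := by
        rw [Real.mul_rpow (by norm_num) (by positivity), ← mul_assoc,
          ← Real.rpow_add (by norm_num), neg_add_cancel, Real.rpow_zero, one_mul,
          ← Real.sqrt_eq_rpow, Real.sqrt_sq hW0]
end
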